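/- For every integer m ≥ 1 there exist a constant C_m > 0 and a natural number n = n(m), depending only on m and f, such that for every M > 0 and every smooth zero-mean function w : S¹ → ℝ with |w|_∞ ≤ M, |⟨L^m w, B(w)⟩| ≤ C_m (1 + M)^n ‖w‖_m ‖w‖_{m+1}, where L = −∂²/∂x², B(w) = 2 f'(w) w_x, and ⟨·,·⟩ is the L² scalar product on S¹. -/

import Mathlib

open MeasureTheory Real Set Filter
open scoped ENNReal Topology

noncomputable section

/-- Lebesgue measure on one period `(0,1]` of the circle `S¹ = ℝ/ℤ`. -/
def cellMeasure : Measure ℝ := volume.restrict (Set.Ioc (0:ℝ) 1)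

/-- The homogeneous Sobolev norm `|w|_{m,p}` of a `1`-periodic function,
i.e. the `L^p` norm over one period of the `m`-th derivative. -/
def sobNorm (m : ℕ) (p : ℝ≥0∞) (w : ℝ → ℝ) : ℝ :=
  (eLpNorm (iteratedDeriv m w) p cellMeasure).toReal

/-- `‖w‖_m = |w|_{m,2}`. -/
def hNorm (m : ℕ) (w : ℝ → ℝ) : ℝ := sobNorm m 2 w

/-- A smooth, `1`-periodic, zero mean value function on the circle. -/
structure ZeroMeanPeriodic (w : ℝ → ℝ) : Prop where
  smooth : ContDiff ℝ (⊤ : ℕ∞) w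
  periodic : Function.Periodic w 1
  zeroMean : ∫ x in (0:ℝ)..1, w x = 0

/-- Structural assumptions on the flux `f` : smoothness, strong convexity
with constant `σ`, and at most polynomial growth of all derivatives. -/
structure BurgersFlux (f : ℝ → ℝ) (σ : ℝ) : Prop where
  smooth : ContDiff ℝ (⊤ : ℕ∞) f
  sigma_pos : 0 < σ
  strongly_convex : ∀ x : ℝ, σ ≤ deriv (deriv f) x
  poly_growth : ∀ m : ℕ, ∃ n : ℕ, ∃ C : ℝ, 0 < C ∧
    ∀ x : ℝ, |iteratedDeriv m f x| ≤ C * (1 + |x|) ^ n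

/-- `u` solves the unforced generalised Burgers equation
`u_t + f'(u) u_x - ν u_xx = 0` classically at all times in `J`. -/
def SolvesBurgers (f : ℝ → ℝ) (ν : ℝ) (u : ℝ → ℝ → ℝ) (J : Set ℝ) : Prop :=
  ∀ t ∈ J, ∀ x : ℝ,
    deriv (fun s => u s x) t + deriv f (u t x) * deriv (u t) x
      - ν * deriv (deriv (u t)) x = 0

/-- The operator `L = -∂²/∂x²`. -/
def Lop (w : ℝ → ℝ) : ℝ → ℝ := fun x => -(deriv (deriv w) x)

lemma gn_maxp (m : ℕ) (hm1 : 1 ≤ m) (Q : ℕ → ℝ)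
    (h : ∀ j, 1 ≤ j → j < m → ∀ B, 0 ≤ B → (∀ i, 1 ≤ i → i ≤ m → Q i ≤ B) → Q j ≤ B / 2)
    (hm : Q m ≤ 1) : ∀ i, 1 ≤ i → i ≤ m → Q i ≤ 1 := by
  obtain ⟨j, hj, hmax⟩ := Finset.exists_max_image (Finset.Icc 1 m) Q ⟨1, by simp [hm1]⟩
  simp only [Finset.mem_Icc] at hj hmax
  intro i hi1 him
  have hij := hmax i ⟨hi1, him⟩
  rcases hj.2.lt_or_eq with hlt | heq
  · have := h j hj.1 hlt (max (Q j) 0) (le_max_right _ _)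
      (fun i h1 h2 => (hmax i ⟨h1, h2⟩).trans (le_max_left _ _))
    rcases le_total (Q j) 0 with h0 | h0
    · linarith
    · rw [max_eq_left h0] at this; linarith
  · subst heq; linarith

lemma gn_hasDeriv (q : ℝ) (hq : 0 < q) (u : ℝ) :
    HasDerivAt (fun u : ℝ => |u| ^ q * u) ((q + 1) * |u| ^ q) u := by
  rcases lt_trichotomy u 0 with h | h | h
  · have h1 : HasDerivAt (fun u : ℝ => (-u) ^ q * u)
        ((-1 * q * (-u) ^ (q - 1)) * u + (-u) ^ q * 1) u :=
      ((hasDerivAt_neg u).rpow_const (Or.inl (by linarith))).mul (hasDerivAt_id u)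
    have h2 : (fun u : ℝ => |u| ^ q * u) =ᶠ[𝓝 u] (fun u : ℝ => (-u) ^ q * u) := by
      filter_upwards [Iio_mem_nhds h] with y hy
      rw [abs_of_neg hy]
    refine (h1.congr_of_eventuallyEq h2).congr_deriv ?_
    rw [abs_of_neg h, Real.rpow_sub_one (by linarith)]
    have : u ≠ 0 := h.ne
    field_simp
  · subst h
    rw [hasDerivAt_iff_tendsto_slope]
    simp only [abs_zero, Real.zero_rpow hq.ne', mul_zero]
    have : Tendsto (fun u : ℝ => |u| ^ q) (𝓝[≠] 0) (𝓝 0) := by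
      have hc : Continuous (fun u : ℝ => |u| ^ q) :=
        continuous_abs.rpow_const (fun _ => Or.inr hq.le)
      have := hc.tendsto 0
      simp only [abs_zero, Real.zero_rpow hq.ne'] at this
      exact this.mono_left nhdsWithin_le_nhds
    refine this.congr' ?_
    filter_upwards [self_mem_nhdsWithin] with y hy
    have : y ≠ 0 := hy
    simp [slope_def_field]
    field_simp
  · have h1 : HasDerivAt (fun u : ℝ => u ^ q * u)
        ((1 * q * u ^ (q - 1)) * u + u ^ q * 1) u :=
      ((hasDerivAt_id u).rpow_const (Or.inl (by simpa using h.ne'))).mul (hasDerivAt_id u)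
    have h2 : (fun u : ℝ => |u| ^ q * u) =ᶠ[𝓝 u] (fun u : ℝ => u ^ q * u) := by
      filter_upwards [Ioi_mem_nhds h] with y hy
      rw [abs_of_pos hy]
    refine (h1.congr_of_eventuallyEq h2).congr_deriv ?_
    rw [abs_of_pos h, Real.rpow_sub_one (by linarith)]
    field_simp

lemma gn_ibp (u v u' v' : ℝ → ℝ) (hu : ∀ x, HasDerivAt u (u' x) x)
    (hv : ∀ x, HasDerivAt v (v' x) x) (hu' : Continuous u') (hv' : Continuous v')
    (pu : u 1 = u 0) (pv : v 1 = v 0) :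
    ∫ x in (0:ℝ)..1, u' x * v x = - ∫ x in (0:ℝ)..1, u x * v' x := by
  have := intervalIntegral.integral_mul_deriv_eq_deriv_mul (a := 0) (b := 1)
    (fun x _ => hu x) (fun x _ => hv x) (hu'.intervalIntegrable _ _) (hv'.intervalIntegrable _ _)
  rw [pu, pv] at this
  linarith

lemma gn_step (q : ℝ) (hq : 0 < q) (v v' v'' : ℝ → ℝ) (hv : ∀ x, HasDerivAt v (v' x) x)
    (hv' : ∀ x, HasDerivAt v' (v'' x) x) (hc : Continuous v'')
    (pv : v 1 = v 0) (pv' : v' 1 = v' 0) :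
    ∫ x in (0:ℝ)..1, |v' x| ^ (q + 2) ≤
      (q + 1) * ∫ x in (0:ℝ)..1, |v x| * |v' x| ^ q * |v'' x| := by
  have c0 : Continuous v := continuous_iff_continuousAt.2 fun x => (hv x).continuousAt
  have c1 : Continuous v' := continuous_iff_continuousAt.2 fun x => (hv' x).continuousAt
  have c2 : Continuous (fun x => |v' x| ^ q) := c1.abs.rpow_const (fun _ => Or.inr hq.le)
  have key := gn_ibp v (fun x => |v' x| ^ q * v' x) v' (fun x => ((q + 1) * |v' x| ^ q) * v'' x)
    hv (fun x => (gn_hasDeriv q hq (v' x)).comp x (hv' x)) c1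
    ((continuous_const.mul c2).mul hc) pv (by simp [pv'])
  have e1 : ∀ x, |v' x| ^ (q + 2) = v' x * (|v' x| ^ q * v' x) := by
    intro x
    rw [Real.rpow_add_of_nonneg (abs_nonneg _) hq.le (by norm_num)]
    have : |v' x| ^ (2:ℝ) = v' x * v' x := by
      rw [Real.rpow_two, sq_abs, sq]
    rw [this]; ring
  simp_rw [e1]
  rw [key, ← intervalIntegral.integral_neg, ← intervalIntegral.integral_const_mul]
  apply intervalIntegral.integral_mono_on zero_le_one
  · exact (c0.mul ((continuous_const.mul c2).mul hc)).neg.intervalIntegrable _ _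
  · exact (continuous_const.mul ((c0.abs.mul c2).mul hc.abs)).intervalIntegrable _ _
  · intro x _
    refine (neg_le_abs _).trans (le_of_eq ?_)
    rw [abs_mul, abs_mul, abs_mul, abs_of_pos (by linarith : 0 < q + 1),
      abs_of_nonneg (Real.rpow_nonneg (abs_nonneg _) q)]
    ring

lemma gn_young (m k : ℕ) (hk : k + 1 < m) (a b c : ℝ) (ha : 0 ≤ a) (hb : 0 ≤ b) (hc : 0 ≤ c)
    (ha1 : k = 0 → a ≤ 1) :
    a * b ^ (2 * (m:ℝ) / ((k + 1 : ℕ) : ℝ) - 2) * c ≤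
      (k : ℝ) / (2 * m) * a ^ (2 * (m:ℝ) / (k : ℝ))
      + (1 - ((k + 1 : ℕ) : ℝ) / m) * b ^ (2 * (m:ℝ) / ((k + 1 : ℕ) : ℝ))
      + ((k + 2 : ℕ) : ℝ) / (2 * m) * c ^ (2 * (m:ℝ) / ((k + 2 : ℕ) : ℝ)) := by
  have hm : (0:ℝ) < m := by exact_mod_cast (by omega : 0 < m)
  have hkm : ((k + 1 : ℕ) : ℝ) / m ≤ 1 := by
    rw [div_le_one hm]; exact_mod_cast hk.le
  have hk1 : (0:ℝ) < ((k + 1 : ℕ) : ℝ) := by positivity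
  have hk2 : (0:ℝ) < ((k + 2 : ℕ) : ℝ) := by positivity
  refine le_trans ?_ (Real.geom_mean_le_arith_mean3_weighted (by positivity) (by linarith)
    (by positivity) (Real.rpow_nonneg ha _) (Real.rpow_nonneg hb _) (Real.rpow_nonneg hc _) ?_)
  · have e1 : a ≤ (a ^ (2 * (m:ℝ) / (k : ℝ))) ^ ((k : ℝ) / (2 * m)) := by
      rcases Nat.eq_zero_or_pos k with h | h
      · simpa [h] using ha1 h
      · have : (0:ℝ) < k := by exact_mod_cast h
        rw [← Real.rpow_mul ha]
        have : 2 * (m:ℝ) / (k : ℝ) * ((k : ℝ) / (2 * m)) = 1 := by field_simp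
        rw [this, Real.rpow_one]
    have e2 : (b ^ (2 * (m:ℝ) / ((k + 1 : ℕ) : ℝ))) ^ (1 - ((k + 1 : ℕ) : ℝ) / m) =
        b ^ (2 * (m:ℝ) / ((k + 1 : ℕ) : ℝ) - 2) := by
      rw [← Real.rpow_mul hb]
      congr 1
      field_simp
    have e3 : (c ^ (2 * (m:ℝ) / ((k + 2 : ℕ) : ℝ))) ^ (((k + 2 : ℕ) : ℝ) / (2 * m)) = c := by
      rw [← Real.rpow_mul hc]
      have : 2 * (m:ℝ) / ((k + 2 : ℕ) : ℝ) * (((k + 2 : ℕ) : ℝ) / (2 * m)) = 1 := by field_simp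
      rw [this, Real.rpow_one]
    rw [e2, e3]
    gcongr
  · push_cast
    field_simp
    ring

lemma gn_Q (m : ℕ) (hm1 : 1 ≤ m) (W : ℕ → ℝ → ℝ) (hW : ∀ j x, HasDerivAt (W j) (W (j + 1) x) x)
    (pW : ∀ j, W j 1 = W j 0) (s : ℕ → ℝ) (hs : ∀ j, 0 < s j)
    (hs2 : ∀ j, 4 * m * (s j * s (j + 2)) ≤ (s (j + 1)) ^ 2)
    (h0 : ∀ x ∈ Icc (0:ℝ) 1, |W 0 x| ≤ s 0)
    (hmm : ∫ x in (0:ℝ)..1, (W m x) ^ 2 ≤ (s m) ^ 2) :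
    ∀ i, 1 ≤ i → i ≤ m → ∫ x in (0:ℝ)..1, (|W i x| / s i) ^ (2 * (m:ℝ) / (i:ℝ)) ≤ 1 := by
  have hm : (0:ℝ) < m := by exact_mod_cast hm1
  have cW : ∀ j, Continuous (W j) :=
    fun j => continuous_iff_continuousAt.2 fun x => (hW j x).continuousAt
  have ca : ∀ j, Continuous (fun x => |W j x| / s j) := fun j => (cW j).abs.div_const _
  have cp : ∀ j (p : ℝ), 0 ≤ p → Continuous (fun x => (|W j x| / s j) ^ p) :=
    fun j p hp => (ca j).rpow_const (fun _ => Or.inr hp)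
  have a0 : ∀ j x, 0 ≤ |W j x| / s j := fun j x => div_nonneg (abs_nonneg _) (hs j).le
  apply gn_maxp m hm1
  · intro j hj hjm B hB hQ
    obtain ⟨k, rfl⟩ : ∃ k, j = k + 1 := ⟨j - 1, by omega⟩
    have hk1 : (0:ℝ) < ((k + 1 : ℕ) : ℝ) := by positivity
    set q : ℝ := 2 * (m:ℝ) / ((k + 1 : ℕ) : ℝ) - 2 with hq
    have hq0 : 0 < q := by
      have : (1:ℝ) < m / ((k + 1 : ℕ) : ℝ) := by
        rw [lt_div_iff₀ hk1, one_mul]; exact_mod_cast hjm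
      rw [hq, mul_div_assoc]; linarith
    have hq1 : q + 2 ≤ 2 * m := by
      rw [hq]
      have : 2 * (m:ℝ) / ((k + 1 : ℕ) : ℝ) ≤ 2 * m := by
        apply div_le_self (by positivity)
        exact_mod_cast hj
      linarith
    have step := gn_step q hq0 (fun x => W k x / s (k + 1)) (fun x => W (k + 1) x / s (k + 1))
      (fun x => W (k + 2) x / s (k + 1)) (fun x => (hW k x).div_const _)
      (fun x => (hW (k + 1) x).div_const _) ((cW _).div_const _) (by simp [pW]) (by simp [pW])
    have eL : ∫ x in (0:ℝ)..1, |W (k + 1) x / s (k + 1)| ^ (q + 2) =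
        ∫ x in (0:ℝ)..1, (|W (k + 1) x| / s (k + 1)) ^ (2 * (m:ℝ) / ((k + 1 : ℕ):ℝ)) := by
      congr 1; ext x
      rw [abs_div, abs_of_pos (hs (k + 1)), hq, sub_add_cancel]
    have eR : ∫ x in (0:ℝ)..1, |W k x / s (k + 1)| * |W (k + 1) x / s (k + 1)| ^ q *
          |W (k + 2) x / s (k + 1)| =
        (s k * s (k + 2) / (s (k + 1)) ^ 2) * ∫ x in (0:ℝ)..1,
          (|W k x| / s k) * (|W (k + 1) x| / s (k + 1)) ^ q * (|W (k + 2) x| / s (k + 2)) := by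
      rw [← intervalIntegral.integral_const_mul]
      congr 1; ext x
      simp only [abs_div, abs_of_pos (hs (k + 1))]
      have := (hs k).ne'
      have := (hs (k + 1)).ne'
      have := (hs (k + 2)).ne'
      field_simp
    have p0 : (0:ℝ) ≤ 2 * (m:ℝ) / (k : ℝ) := by positivity
    have p1 : (0:ℝ) ≤ 2 * (m:ℝ) / ((k + 1 : ℕ) : ℝ) := by positivity
    have p2 : (0:ℝ) ≤ 2 * (m:ℝ) / ((k + 2 : ℕ) : ℝ) := by positivity
    have i0 := ((cp k _ p0).const_mul ((k : ℝ) / (2 * m))).intervalIntegrable (μ := volume) 0 1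
    have i1 := ((cp (k + 1) _ p1).const_mul
      (1 - ((k + 1 : ℕ) : ℝ) / m)).intervalIntegrable (μ := volume) 0 1
    have i2 := ((cp (k + 2) _ p2).const_mul
      (((k + 2 : ℕ) : ℝ) / (2 * m))).intervalIntegrable (μ := volume) 0 1
    have hI : ∫ x in (0:ℝ)..1,
          (|W k x| / s k) * (|W (k + 1) x| / s (k + 1)) ^ q * (|W (k + 2) x| / s (k + 2)) ≤ B := by
      have mono := intervalIntegral.integral_mono_on (μ := volume) zero_le_one
        ((((ca k).mul (cp (k + 1) q hq0.le)).mul (ca (k + 2))).intervalIntegrable 0 1)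
        ((i0.add i1).add i2)
        (fun x hx => gn_young m k hjm (|W k x| / s k) (|W (k + 1) x| / s (k + 1))
          (|W (k + 2) x| / s (k + 2)) (a0 _ _) (a0 _ _) (a0 _ _) (by
            intro h
            rw [h, div_le_one (hs 0)]
            exact h0 x hx))
      refine mono.trans ?_
      rw [intervalIntegral.integral_add (i0.add i1) i2, intervalIntegral.integral_add i0 i1,
        intervalIntegral.integral_const_mul, intervalIntegral.integral_const_mul,
        intervalIntegral.integral_const_mul]
      have b1 := hQ (k + 1) (by omega) (by omega)
      have b2 := hQ (k + 2) (by omega) (by omega)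
      have hkm : 0 ≤ 1 - ((k + 1 : ℕ) : ℝ) / m := by
        rw [sub_nonneg, div_le_one hm]; exact_mod_cast hjm.le
      have t0 : (k : ℝ) / (2 * m) * ∫ x in (0:ℝ)..1, (|W k x| / s k) ^ (2 * (m:ℝ) / (k:ℝ)) ≤
          (k : ℝ) / (2 * m) * B := by
        rcases Nat.eq_zero_or_pos k with h | h
        · simp [h]
        · exact mul_le_mul_of_nonneg_left (hQ k h (by omega)) (by positivity)
      have t1 := mul_le_mul_of_nonneg_left b1 hkm
      have t2 := mul_le_mul_of_nonneg_left b2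
        (by positivity : 0 ≤ ((k + 2 : ℕ) : ℝ) / (2 * (m:ℝ)))
      have : (k : ℝ) / (2 * m) * B + (1 - ((k + 1 : ℕ) : ℝ) / m) * B +
          ((k + 2 : ℕ) : ℝ) / (2 * (m:ℝ)) * B = B := by
        push_cast
        field_simp
        ring
      linarith
    rw [eL, eR] at step
    refine step.trans ?_
    have hsk := hs (k + 1)
    have hr : (q + 1) * (s k * s (k + 2) / (s (k + 1)) ^ 2) ≤ 1 / 2 := by
      rw [← mul_div_assoc, div_le_iff₀ (by positivity)]
      have := hs2 k
      have hss := mul_pos (hs k) (hs (k + 2))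
      nlinarith
    have hr0 : 0 ≤ (q + 1) * (s k * s (k + 2) / (s (k + 1)) ^ 2) := by
      have := hs k
      have := hs (k + 2)
      positivity
    calc _ = ((q + 1) * (s k * s (k + 2) / (s (k + 1)) ^ 2)) * _ := by rw [mul_assoc]
      _ ≤ ((q + 1) * (s k * s (k + 2) / (s (k + 1)) ^ 2)) * B :=
        mul_le_mul_of_nonneg_left hI hr0
      _ ≤ 1 / 2 * B := mul_le_mul_of_nonneg_right hr hB
      _ = B / 2 := by ring
  · have e : 2 * (m:ℝ) / (m:ℝ) = 2 := by field_simp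
    have : ∀ x, (|W m x| / s m) ^ (2 * (m:ℝ) / (m:ℝ)) = (W m x) ^ 2 / (s m) ^ 2 := by
      intro x
      rw [e, Real.rpow_two, div_pow, sq_abs]
    simp_rw [this]
    rw [intervalIntegral.integral_div]
    have := hs m
    rw [div_le_one (by positivity)]
    exact hmm

lemma gn_main (m : ℕ) (hm1 : 1 ≤ m) (W : ℕ → ℝ → ℝ)
    (hW : ∀ j x, HasDerivAt (W j) (W (j + 1) x) x)
    (pW : ∀ j, W j 1 = W j 0) (M : ℝ) (hM : 0 < M)
    (h0 : ∀ x ∈ Icc (0:ℝ) 1, |W 0 x| ≤ M) (y : ℝ) (hy : 0 < y)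
    (hmm : ∫ x in (0:ℝ)..1, (W m x) ^ 2 ≤ y ^ 2) :
    ∀ i, 1 ≤ i → i ≤ m → ∫ x in (0:ℝ)..1, |W i x| ^ (2 * (m:ℝ) / (i:ℝ)) ≤
      (1 + M) ^ (2 * m) * ((2 * (m:ℝ)) ^ (m ^ 2)) ^ 2 * y ^ 2 := by
  have hm : (0:ℝ) < m := by exact_mod_cast hm1
  have hm1' : (1:ℝ) ≤ m := by exact_mod_cast hm1
  set c : ℝ := 2 * (m:ℝ) with hc
  have hc0 : 0 < c := by positivity
  set x : ℝ := (c ^ (m ^ 2) * y / M) ^ (1 / (m:ℝ)) with hx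
  have hx0 : 0 < x := by positivity
  have hxm : x ^ m = c ^ (m ^ 2) * y / M := by
    rw [hx, ← Real.rpow_natCast, ← Real.rpow_mul (by positivity)]
    rw [one_div_mul_cancel hm.ne', Real.rpow_one]
  set s : ℕ → ℝ := fun j => M * x ^ j / c ^ (j ^ 2) with hs
  have hs0 : ∀ j, 0 < s j := fun j => by simp only [hs]; positivity
  have hQ := gn_Q m hm1 W hW pW s hs0 (by
    intro j
    have e : (s (j + 1)) ^ 2 = c ^ 2 * (s j * s (j + 2)) := by
      simp only [hs]
      field_simp
      ring
    rw [e]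
    apply mul_le_mul_of_nonneg_right _ (mul_pos (hs0 _) (hs0 _)).le
    rw [hc]; nlinarith) (by simpa [hs] using h0) (by
    have : s m = y := by
      simp only [hs]
      rw [hxm]
      field_simp
    rwa [this])
  intro i hi him
  have hi0 : (0:ℝ) < i := by exact_mod_cast hi
  have him' : (i:ℝ) ≤ m := by exact_mod_cast him
  have h1i : (1:ℝ) ≤ i := by exact_mod_cast hi
  have e : ∀ t, |W i t| ^ (2 * (m:ℝ) / (i:ℝ)) =
      (s i) ^ (2 * (m:ℝ) / (i:ℝ)) * (|W i t| / s i) ^ (2 * (m:ℝ) / (i:ℝ)) := by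
    intro t
    rw [← Real.mul_rpow (hs0 i).le (div_nonneg (abs_nonneg _) (hs0 i).le)]
    rw [mul_div_cancel₀ _ (hs0 i).ne']
  simp_rw [← hc] at hQ e ⊢
  simp_rw [e]
  rw [intervalIntegral.integral_const_mul]
  have hp0 : 0 ≤ c / (i:ℝ) := by positivity
  calc _ ≤ (s i) ^ (c / (i:ℝ)) * 1 :=
        mul_le_mul_of_nonneg_left (hQ i hi him) (Real.rpow_nonneg (hs0 i).le _)
    _ ≤ (M * x ^ i) ^ (c / (i:ℝ)) := by
        rw [mul_one]
        apply Real.rpow_le_rpow (hs0 i).le _ hp0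
        simp only [hs]
        apply div_le_self (by positivity)
        apply one_le_pow₀
        rw [hc]; linarith
    _ = M ^ (c / (i:ℝ)) * (x ^ m) ^ 2 := by
        rw [Real.mul_rpow hM.le (by positivity)]
        congr 1
        rw [← Real.rpow_natCast x i, ← Real.rpow_mul hx0.le, ← pow_mul, ← Real.rpow_natCast]
        congr 1
        rw [hc]; push_cast; field_simp
    _ = M ^ (c / (i:ℝ) - 2) * (c ^ (m ^ 2)) ^ 2 * y ^ 2 := by
        rw [hxm, Real.rpow_sub hM, Real.rpow_two]
        field_simp
    _ ≤ _ := by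
        gcongr
        have h2 : 0 ≤ c / (i:ℝ) - 2 := by
          rw [sub_nonneg, le_div_iff₀ hi0, hc]; linarith
        calc M ^ (c / (i:ℝ) - 2) ≤ (1 + M) ^ (c / (i:ℝ) - 2) :=
              Real.rpow_le_rpow hM.le (by linarith) h2
          _ ≤ (1 + M) ^ (((2 * m : ℕ)) : ℝ) := by
              apply Real.rpow_le_rpow_of_exponent_le (by linarith)
              have : c / (i:ℝ) ≤ c := div_le_self hc0.le h1i
              push_cast
              linarith
          _ = _ := Real.rpow_natCast _ _

lemma gn_iter_hasDeriv (w : ℝ → ℝ) (hw : ContDiff ℝ (⊤ : ℕ∞) w) (j : ℕ) (x : ℝ) :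
    HasDerivAt (iteratedDeriv j w) (iteratedDeriv (j + 1) w x) x := by
  rw [iteratedDeriv_succ]
  exact ((hw.differentiable_iteratedDeriv j (by exact_mod_cast WithTop.coe_lt_top _)) x).hasDerivAt

lemma gn_iter_cont (w : ℝ → ℝ) (hw : ContDiff ℝ (⊤ : ℕ∞) w) (j : ℕ) :
    Continuous (iteratedDeriv j w) :=
  continuous_iff_continuousAt.2 fun x => (gn_iter_hasDeriv w hw j x).continuousAt

lemma gn_iter_per (w : ℝ → ℝ) (hw : Function.Periodic w 1) (j : ℕ) :
    iteratedDeriv j w 1 = iteratedDeriv j w 0 := by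
  have h : (fun x => w (x + 1)) = w := funext hw
  have := congrFun (iteratedDeriv_comp_add_const j w 1) 0
  simp only [zero_add] at this
  rw [← this, h]

lemma gn_Lop (w : ℝ → ℝ) (m : ℕ) :
    Lop^[m] w = fun x => (-1) ^ m * iteratedDeriv (2 * m) w x := by
  induction m with
  | zero => simp
  | succ k ih =>
    rw [Function.iterate_succ_apply', ih]
    funext x
    simp only [Lop]
    have e1 : deriv (fun x => (-1 : ℝ) ^ k * iteratedDeriv (2 * k) w x) =
        fun x => (-1 : ℝ) ^ k * iteratedDeriv (2 * k + 1) w x := by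
      funext x; rw [deriv_const_mul_field, iteratedDeriv_succ]
    rw [e1, deriv_const_mul_field, show 2 * (k + 1) = 2 * k + 1 + 1 by ring,
      iteratedDeriv_succ (n := 2 * k + 1), pow_succ]
    ring

lemma gn_ibp_iter (w g : ℝ → ℝ) (hw : ContDiff ℝ (⊤ : ℕ∞) w) (hg : ContDiff ℝ (⊤ : ℕ∞) g)
    (pw : Function.Periodic w 1) (pg : Function.Periodic g 1) (k : ℕ) : ∀ a b : ℕ,
    ∫ x in (0:ℝ)..1, iteratedDeriv (a + k) w x * iteratedDeriv b g x =
      (-1) ^ k * ∫ x in (0:ℝ)..1, iteratedDeriv a w x * iteratedDeriv (b + k) g x := by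
  induction k with
  | zero => intro a b; simp
  | succ k ih =>
    intro a b
    rw [← add_assoc, gn_ibp (iteratedDeriv (a + k) w) (iteratedDeriv b g) _ _
      (gn_iter_hasDeriv w hw _) (gn_iter_hasDeriv g hg _) (gn_iter_cont w hw _)
      (gn_iter_cont g hg _) (gn_iter_per w pw _) (gn_iter_per g pg _), ih a (b + 1),
      show b + 1 + k = b + (k + 1) by ring, pow_succ]
    ring

lemma gn_hNorm_nonneg (m : ℕ) (w : ℝ → ℝ) : 0 ≤ hNorm m w := ENNReal.toReal_nonneg

lemma gn_hNorm (w : ℝ → ℝ) (hw : ContDiff ℝ (⊤ : ℕ∞) w) (m : ℕ) :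
    ∫ x in (0:ℝ)..1, (iteratedDeriv m w x) ^ 2 = (hNorm m w) ^ 2 := by
  have hc := gn_iter_cont w hw m
  have hmem : MemLp (iteratedDeriv m w) 2 cellMeasure := by
    rw [memLp_two_iff_integrable_sq (by exact hc.aestronglyMeasurable)]
    have : IntegrableOn (fun x => iteratedDeriv m w x ^ 2) (Ioc 0 1) :=
      ((hc.pow 2).continuousOn.integrableOn_Icc (a := 0) (b := 1)).mono_set Ioc_subset_Icc_self
    exact this
  have hnn : 0 ≤ ∫ x, iteratedDeriv m w x ^ 2 ∂cellMeasure :=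
    integral_nonneg fun x => sq_nonneg _
  rw [hNorm, sobNorm, hmem.eLpNorm_eq_integral_rpow_norm (by norm_num) (by norm_num)]
  simp only [ENNReal.toReal_ofNat, Real.rpow_two, Real.norm_eq_abs, sq_abs]
  rw [ENNReal.toReal_ofReal (by positivity), ← Real.rpow_natCast (_ ^ _) 2,
    ← Real.rpow_mul hnn, intervalIntegral.integral_of_le zero_le_one]
  norm_num
  rfl

lemma gn_sup (w : ℝ → ℝ) (hw : Continuous w) (M : ℝ) (h : sobNorm 0 ⊤ w ≤ M) :
    ∀ x ∈ Icc (0:ℝ) 1, |w x| ≤ M := by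
  have hM : 0 ≤ M := le_trans ENNReal.toReal_nonneg h
  simp only [sobNorm, iteratedDeriv_zero, eLpNorm_exponent_top] at h
  obtain ⟨K, hK⟩ := isCompact_Icc.exists_bound_of_continuousOn (hw.continuousOn (s := Icc (0:ℝ) 1))
  have hfin : eLpNormEssSup w cellMeasure ≠ ⊤ := by
    refine (lt_of_le_of_lt (eLpNormEssSup_le_of_ae_bound (C := K) ?_) ENNReal.ofReal_lt_top).ne
    exact (ae_restrict_iff' measurableSet_Ioc).2 (ae_of_all _ fun x hx =>
      hK x (Ioc_subset_Icc_self hx))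
  have hae : ∀ᵐ x ∂cellMeasure, |w x| ≤ M := by
    filter_upwards [ae_le_eLpNormEssSup (f := w) (μ := cellMeasure)] with x hx
    have := (ENNReal.toReal_mono hfin hx).trans h
    simpa using this
  have hae2 : (fun x => max (|w x|) M) =ᵐ[volume.restrict (Icc (0:ℝ) 1)] fun _ => M := by
    rw [← restrict_Ioc_eq_restrict_Icc]
    filter_upwards [hae] with x hx
    exact max_eq_right hx
  have := Measure.eqOn_Icc_of_ae_eq volume (by norm_num : (0:ℝ) ≠ 1) hae2
    (hw.abs.max continuous_const).continuousOn continuousOn_const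
  intro x hx
  exact max_eq_right_iff.1 (this hx)

lemma gn_cs (u v : ℝ → ℝ) (hu : Continuous u) (hv : Continuous v) (y z : ℝ) (hy : 0 < y)
    (hz : 0 < z) (h1 : ∫ x in (0:ℝ)..1, (u x) ^ 2 ≤ y ^ 2)
    (h2 : ∫ x in (0:ℝ)..1, (v x) ^ 2 ≤ z ^ 2) :
    |∫ x in (0:ℝ)..1, u x * v x| ≤ y * z := by
  have i1 := ((hu.pow 2).const_mul (z / (2 * y))).intervalIntegrable (μ := volume) 0 1
  have i2 := ((hv.pow 2).const_mul (y / (2 * z))).intervalIntegrable (μ := volume) 0 1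
  refine (intervalIntegral.abs_integral_le_integral_abs zero_le_one).trans ?_
  refine (intervalIntegral.integral_mono_on zero_le_one
    ((hu.mul hv).abs.intervalIntegrable _ _) (i1.add i2) (fun x _ => ?_)).trans ?_
  · show |u x * v x| ≤ z / (2 * y) * u x ^ 2 + y / (2 * z) * v x ^ 2
    rw [abs_mul, ← sq_abs (u x), ← sq_abs (v x)]
    have : z / (2 * y) * |u x| ^ 2 + y / (2 * z) * |v x| ^ 2 - |u x| * |v x| =
      (z * |u x| - y * |v x|) ^ 2 / (2 * y * z) := by field_simp; ring
    have h : 0 ≤ (z * |u x| - y * |v x|) ^ 2 / (2 * y * z) := by positivity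
    linarith
  · rw [intervalIntegral.integral_add i1 i2, intervalIntegral.integral_const_mul,
      intervalIntegral.integral_const_mul]
    have a1 := mul_le_mul_of_nonneg_left h1 (by positivity : 0 ≤ z / (2 * y))
    have a2 := mul_le_mul_of_nonneg_left h2 (by positivity : 0 ≤ y / (2 * z))
    have : z / (2 * y) * y ^ 2 + y / (2 * z) * z ^ 2 = y * z := by field_simp; ring
    simp only [Pi.pow_apply]
    linarith

lemma gn_growth (f : ℝ → ℝ) (σ : ℝ) (hf : BurgersFlux f σ) (m : ℕ) :
    ∃ C : ℝ, 0 < C ∧ ∃ N : ℕ, ∀ M t : ℝ, |t| ≤ M → ∀ i ≤ m,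
      |iteratedDeriv i f t| ≤ C * (1 + M) ^ N := by
  choose n C hC h using hf.poly_growth
  refine ⟨∑ i ∈ Finset.range (m + 1), C i, Finset.sum_pos (fun i _ => hC i) ⟨0, by simp⟩,
    ∑ i ∈ Finset.range (m + 1), n i, ?_⟩
  intro M t ht i hi
  have hmem : i ∈ Finset.range (m + 1) := by simp; omega
  have h1 : C i ≤ ∑ i ∈ Finset.range (m + 1), C i :=
    Finset.single_le_sum (fun i _ => (hC i).le) hmem
  have h2 : n i ≤ ∑ i ∈ Finset.range (m + 1), n i :=
    Finset.single_le_sum (fun i _ => Nat.zero_le _) hmem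
  have ht0 := abs_nonneg t
  calc _ ≤ C i * (1 + |t|) ^ n i := h i t
    _ ≤ (∑ i ∈ Finset.range (m + 1), C i) * (1 + M) ^ n i := by
        have := hC i
        have : 0 ≤ ∑ i ∈ Finset.range (m + 1), C i := (hC i).le.trans h1
        gcongr
    _ ≤ _ := by
        have : 0 ≤ ∑ i ∈ Finset.range (m + 1), C i := (hC i).le.trans h1
        gcongr
        linarith

lemma gn_comp (f w : ℝ → ℝ) (hf : ContDiff ℝ (⊤ : ℕ∞) f) (hw : ContDiff ℝ (⊤ : ℕ∞) w)
    (m : ℕ) (hm : 1 ≤ m) (A : ℝ) (x : ℝ)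
    (hA : ∀ i ≤ m, |iteratedDeriv i f (w x)| ≤ A) :
    (iteratedDeriv m (f ∘ w) x) ^ 2 ≤ ((m.factorial : ℝ) * A) ^ 2 *
      ∑ i ∈ Finset.Icc 1 m, |iteratedDeriv i w x| ^ (2 * (m:ℝ) / (i:ℝ)) := by
  have hm0 : (0:ℝ) < m := by exact_mod_cast hm
  have hnn : ∀ i ∈ Finset.Icc 1 m, 0 ≤ |iteratedDeriv i w x| ^ (2 * (m:ℝ) / (i:ℝ)) :=
    fun i _ => Real.rpow_nonneg (abs_nonneg _) _
  set S := ∑ i ∈ Finset.Icc 1 m, |iteratedDeriv i w x| ^ (2 * (m:ℝ) / (i:ℝ)) with hS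
  have hS0 : 0 ≤ S := Finset.sum_nonneg hnn
  have key := norm_iteratedFDeriv_comp_le (n := m) hf hw (by exact_mod_cast le_top) x (C := A)
    (D := S ^ (1 / (2 * (m:ℝ)))) (by
      intro i hi
      rw [norm_iteratedFDeriv_eq_norm_iteratedDeriv]
      exact hA i hi) (by
      intro i hi him
      have hi0 : (0:ℝ) < i := by exact_mod_cast hi
      rw [norm_iteratedFDeriv_eq_norm_iteratedDeriv, Real.norm_eq_abs]
      have h1 : |iteratedDeriv i w x| ^ (2 * (m:ℝ) / (i:ℝ)) ≤ S :=
        Finset.single_le_sum hnn (by simp [hi, him])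
      have h2 := Real.rpow_le_rpow (Real.rpow_nonneg (abs_nonneg _) _) h1
        (by positivity : 0 ≤ (i:ℝ) / (2 * m))
      rw [← Real.rpow_mul (abs_nonneg _)] at h2
      have e : 2 * (m:ℝ) / (i:ℝ) * ((i:ℝ) / (2 * m)) = 1 := by field_simp
      rw [e, Real.rpow_one] at h2
      rw [← Real.rpow_natCast, ← Real.rpow_mul hS0]
      refine h2.trans (le_of_eq ?_)
      congr 1
      field_simp)
  rw [norm_iteratedFDeriv_eq_norm_iteratedDeriv, Real.norm_eq_abs] at key
  have h3 := pow_le_pow_left₀ (abs_nonneg _) key 2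
  rw [sq_abs, mul_pow] at h3
  refine h3.trans (le_of_eq ?_)
  congr 1
  rw [← pow_mul, ← Real.rpow_natCast, ← Real.rpow_mul hS0]
  have : 1 / (2 * (m:ℝ)) * ((m * 2 : ℕ) : ℝ) = 1 := by push_cast; field_simp
  rw [this, Real.rpow_one]

lemma gn_final (f : ℝ → ℝ) (σ : ℝ) (hf : BurgersFlux f σ) (m : ℕ) (hm : 1 ≤ m) :
    ∃ C : ℝ, 0 < C ∧ ∃ n : ℕ,
      ∀ M : ℝ, 0 < M → ∀ w : ℝ → ℝ, ZeroMeanPeriodic w → sobNorm 0 ⊤ w ≤ M →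
        ∀ ε : ℝ, 0 < ε →
        |∫ x in (0:ℝ)..1, (Lop^[m] w) x * (2 * deriv f (w x) * deriv w x)|
          ≤ C * (1 + M) ^ n * (hNorm m w + ε) * (hNorm (m + 1) w + ε) := by
  obtain ⟨Cf, hCf, N, hgrow⟩ := gn_growth f σ hf m
  have hm0 : (0:ℝ) < m := by exact_mod_cast hm
  have hm1 : (1:ℝ) ≤ m := by exact_mod_cast hm
  refine ⟨2 * (m.factorial * Cf * m * (2 * (m:ℝ)) ^ (m ^ 2)), by positivity, N + m, ?_⟩
  intro M hM w hw hwM ε hε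
  have hsup := gn_sup w hw.smooth.continuous M hwM
  have hg : ContDiff ℝ (⊤ : ℕ∞) (f ∘ w) := hf.smooth.comp hw.smooth
  have pg : Function.Periodic (f ∘ w) 1 := fun x => by simp [hw.periodic x]
  have hn0 := gn_hNorm_nonneg m w
  have hn1 := gn_hNorm_nonneg (m + 1) w
  set y := hNorm m w + ε with hy
  set z := hNorm (m + 1) w + ε with hz
  have hy0 : 0 < y := by linarith
  have hz0 : 0 < z := by linarith
  have hGN := gn_main m hm (fun j => iteratedDeriv j w) (gn_iter_hasDeriv w hw.smooth)
    (gn_iter_per w hw.periodic) M hM (by simpa using hsup) y hy0 (by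
      rw [gn_hNorm w hw.smooth]; gcongr; linarith)
  set R : ℝ := (1 + M) ^ m * (2 * (m:ℝ)) ^ (m ^ 2) * y with hR
  have hR0 : 0 < R := by positivity
  set A : ℝ := Cf * (1 + M) ^ N with hA
  have hA0 : 0 < A := by positivity
  have cp : ∀ i : ℕ, Continuous (fun x => |iteratedDeriv i w x| ^ (2 * (m:ℝ) / (i:ℝ))) :=
    fun i => (gn_iter_cont w hw.smooth i).abs.rpow_const (fun _ => Or.inr (by positivity))
  have hcomp : ∫ x in (0:ℝ)..1, (iteratedDeriv m (f ∘ w) x) ^ 2 ≤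
      (m.factorial * A * m * R) ^ 2 := by
    refine (intervalIntegral.integral_mono_on (μ := volume) zero_le_one
      (((gn_iter_cont _ hg m).pow 2).intervalIntegrable _ _)
      ((continuous_const.mul (continuous_finsetSum _ fun i _ => cp i)).intervalIntegrable _ _)
      (fun x hx => gn_comp f w hf.smooth hw.smooth m hm A x
        (fun i hi => hgrow M (w x) (hsup x hx) i hi))).trans ?_
    simp only [Pi.mul_apply]
    rw [intervalIntegral.integral_const_mul, intervalIntegral.integral_finset_sum
      (fun i _ => (cp i).intervalIntegrable _ _)]
    have hsum : ∑ i ∈ Finset.Icc 1 m, ∫ x in (0:ℝ)..1,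
        |iteratedDeriv i w x| ^ (2 * (m:ℝ) / (i:ℝ)) ≤ m * R ^ 2 := by
      refine (Finset.sum_le_card_nsmul _ _ (R ^ 2) ?_).trans (le_of_eq (by simp))
      intro i hi
      simp only [Finset.mem_Icc] at hi
      refine (hGN i hi.1 hi.2).trans (le_of_eq ?_)
      rw [hR]; ring
    calc _ ≤ (m.factorial * A) ^ 2 * (m * R ^ 2) :=
          mul_le_mul_of_nonneg_left hsum (by positivity)
      _ ≤ (m.factorial * A) ^ 2 * (m ^ 2 * R ^ 2) := by
          gcongr
          nlinarith
      _ = _ := by ring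
  have hB : ∀ x, deriv f (w x) * deriv w x = iteratedDeriv 1 (f ∘ w) x := by
    intro x
    rw [iteratedDeriv_one, deriv_comp]
    · exact (hf.smooth.differentiable (by simp)) _
    · exact (hw.smooth.differentiable (by simp)) _
  have hI : ∫ x in (0:ℝ)..1, (Lop^[m] w) x * (2 * deriv f (w x) * deriv w x) =
      (-1) ^ m * 2 * ((-1) ^ (m - 1) *
        ∫ x in (0:ℝ)..1, iteratedDeriv (m + 1) w x * iteratedDeriv m (f ∘ w) x) := by
    have := gn_ibp_iter w (f ∘ w) hw.smooth hg hw.periodic pg (m - 1) (m + 1) 1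
    rw [show m + 1 + (m - 1) = 2 * m by omega, show 1 + (m - 1) = m by omega] at this
    rw [← this, ← intervalIntegral.integral_const_mul, gn_Lop]
    congr 1; ext x
    rw [← hB]; ring
  rw [hI]
  simp only [abs_mul, abs_pow, abs_neg, abs_one, one_pow, one_mul, abs_two]
  have := gn_cs _ _ (gn_iter_cont w hw.smooth (m + 1)) (gn_iter_cont _ hg m) z _ hz0
    (by positivity : 0 < m.factorial * A * m * R) (by
      rw [gn_hNorm w hw.smooth]; gcongr; linarith) hcomp
  calc _ ≤ 2 * (z * (m.factorial * A * m * R)) := by linarith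
    _ = _ := by rw [hA, hR, pow_add]; ring

/-- For every `m ≥ 1` there are `C_m > 0` and `n = n(m) ∈ ℕ`,
depending only on `m` and `f`, such that for every `M > 0` and every smooth zero mean
value `w` with `|w|_∞ ≤ M`, `|⟨L^m w, B(w)⟩| ≤ C_m (1+M)^n ‖w‖_m ‖w‖_{m+1}`,
where `B(w) = 2 f'(w) w_x`. -/
theorem statement10 (f : ℝ → ℝ) (σ : ℝ) (hf : BurgersFlux f σ) :
    ∀ m : ℕ, 1 ≤ m → ∃ C : ℝ, 0 < C ∧ ∃ n : ℕ,
      ∀ M : ℝ, 0 < M → ∀ w : ℝ → ℝ, ZeroMeanPeriodic w → sobNorm 0 ⊤ w ≤ M →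
        |∫ x in (0:ℝ)..1, (Lop^[m] w) x * (2 * deriv f (w x) * deriv w x)|
          ≤ C * (1 + M) ^ n * hNorm m w * hNorm (m + 1) w := by

  intro m hm
  obtain ⟨C, hC, n, h⟩ := gn_final f σ hf m hm
  refine ⟨C, hC, n, ?_⟩
  intro M hM w hw hwM
  have hlim : Tendsto (fun ε : ℝ => C * (1 + M) ^ n * (hNorm m w + ε) * (hNorm (m + 1) w + ε))
      (𝓝[>] 0) (𝓝 (C * (1 + M) ^ n * hNorm m w * hNorm (m + 1) w)) := by
    have hc : Continuous
        (fun ε : ℝ => C * (1 + M) ^ n * (hNorm m w + ε) * (hNorm (m + 1) w + ε)) := by fun_prop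
    have := hc.tendsto 0
    simp only [add_zero] at this
    exact this.mono_left nhdsWithin_le_nhds
  refine ge_of_tendsto hlim ?_
  filter_upwards [self_mem_nhdsWithin] with ε hε
  exact h M hM w hw hwM ε hε

end
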